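/- arXiv:2308.08714 — 2 statements merged into one kernel-verified Lean document; each statement's English description precedes it below -/
import Mathlib

section
/- Let S and A be nonempty finite sets, r : S × A → ℝ, γ ∈ [0, 1), and p : S × A × S → ℝ with p(s, a; s') ≥ 0 and Σ_{s' ∈ S} p(s, a; s') = 1 for all (s, a). Then there exists a unique function Q* : S × A → ℝ satisfying the Bellman optimality equation Q*(s, a) = r(s, a) + γ Σ_{s' ∈ S} p(s, a; s') max_{a' ∈ A} Q*(s', a') for all (s, a) ∈ S × A. -/
theorem sup'_univ_le_add_dist {A : Type*} [Fintype A] [Nonempty A] (f g : A → ℝ) :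
    Finset.univ.sup' Finset.univ_nonempty f ≤
      Finset.univ.sup' Finset.univ_nonempty g + dist f g := by
  refine Finset.sup'_le _ _ fun a ha => ?_
  have hg := Finset.le_sup' g ha
  have hfg := (le_abs_self _).trans (dist_le_pi_dist f g a)
  linarith

theorem dist_sup'_univ_le {A : Type*} [Fintype A] [Nonempty A] (f g : A → ℝ) :
    dist (Finset.univ.sup' Finset.univ_nonempty f)
      (Finset.univ.sup' Finset.univ_nonempty g) ≤ dist f g := by
  have hfg := sup'_univ_le_add_dist f g
  have hgf := sup'_univ_le_add_dist g f
  rw [dist_comm] at hgf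
  rw [Real.dist_eq, abs_le]
  constructor <;> linarith

theorem dist_weighted_sum_le {S : Type*} [Fintype S] {w : S → ℝ} (hw0 : ∀ s, 0 ≤ w s)
    (hw1 : ∑ s, w s = 1) {u v : S → ℝ} {C : ℝ} (huv : ∀ s, dist (u s) (v s) ≤ C) :
    dist (∑ s, w s * u s) (∑ s, w s * v s) ≤ C := by
  calc dist (∑ s, w s * u s) (∑ s, w s * v s)
      ≤ ∑ s, dist (w s * u s) (w s * v s) := dist_sum_sum_le _ _ _
    _ ≤ ∑ s, w s * C := by
      refine Finset.sum_le_sum fun s _ => ?_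
      rw [Real.dist_eq, ← mul_sub, abs_mul, abs_of_nonneg (hw0 s)]
      exact mul_le_mul_of_nonneg_left (huv s) (hw0 s)
    _ = C := by rw [← Finset.sum_mul, hw1, one_mul]

/-- Existence and uniqueness of the optimal Q-function: there is a unique
`Q* : S × A → ℝ` satisfying the Bellman optimality equation
`Q*(s, a) = r(s, a) + γ ∑_{s'} p(s, a; s') max_{a'} Q*(s', a')`. -/
theorem bellman_fixed_point_exists_unique
    {S A : Type*} [Fintype S] [Fintype A] [Nonempty S] [Nonempty A]
    (r : S → A → ℝ) (γ : ℝ) (hγ0 : 0 ≤ γ) (hγ1 : γ < 1)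
    (p : S → A → S → ℝ)
    (hp0 : ∀ s a s', 0 ≤ p s a s') (hp1 : ∀ s a, ∑ s', p s a s' = 1) :
    ∃! Qstar : S → A → ℝ, ∀ s a,
      Qstar s a = r s a + γ * ∑ s', p s a s' *
        (Finset.univ.sup' Finset.univ_nonempty fun a' => Qstar s' a') := by
  let T : (S → A → ℝ) → S → A → ℝ := fun Q s a =>
    r s a + γ * ∑ s', p s a s' * Finset.univ.sup' Finset.univ_nonempty fun a' => Q s' a'
  have hT : ContractingWith ⟨γ, hγ0⟩ T := by
    refine ⟨hγ1, LipschitzWith.of_dist_le_mul fun Q Q' => ?_⟩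
    have hC : 0 ≤ γ * dist Q Q' := mul_nonneg hγ0 dist_nonneg
    refine (dist_pi_le_iff hC).2 fun s => (dist_pi_le_iff hC).2 fun a => ?_
    rw [dist_add_left, Real.dist_eq, ← mul_sub, abs_mul, abs_of_nonneg hγ0]
    exact mul_le_mul_of_nonneg_left (dist_weighted_sum_le (hp0 s a) (hp1 s a) fun s' =>
      (dist_sup'_univ_le (Q s') (Q' s')).trans (dist_le_pi_dist Q Q' s')) hγ0
  refine ⟨hT.fixedPoint, fun s a => (congrFun₂ hT.fixedPoint_isFixedPt s a).symm, fun Q hQ => ?_⟩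
  exact hT.fixedPoint_unique (funext₂ fun s a => (hQ s a).symm)
end

section
/- Let S and A be nonempty finite sets, r : S × A → ℝ, γ ∈ [0, 1), α ∈ (0, 1], and p : S × A × S → ℝ with p(s, a; s') ≥ 0 and Σ_{s' ∈ S} p(s, a; s') = 1 for all (s, a). Let L be the Q-learning operator (L Q)(s, a) = (1 - α) Q(s, a) + α ( r(s, a) + γ Σ_{s'} p(s, a; s') max_{a'} Q(s', a') ), and let Q* be the unique function satisfying Q*(s, a) = r(s, a) + γ Σ_{s'} p(s, a; s') max_{a'} Q*(s', a'). Then for any initial Q₀ : S × A → ℝ, the iterates Q_{k+1} = L Q_k satisfy ‖Q_k - Q*‖_∞ ≤ (1 - α(1 - γ))^k ‖Q₀ - Q*‖_∞ for all k, and hence Q_k converges to Q* in the supremum norm (convergence of Q-learning to the optimal Q function). -/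
/-- The Q-learning update operator
`(L Q)(s, a) = (1 - α) Q(s, a) + α (r(s, a) + γ ∑_{s'} p(s, a; s') max_{a'} Q(s', a'))`. -/
noncomputable def qLearningOp {S A : Type*} [Fintype S] [Fintype A] [Nonempty A]
    (r : S → A → ℝ) (γ α : ℝ) (p : S → A → S → ℝ) (Q : S → A → ℝ) : S → A → ℝ :=
  fun s a => (1 - α) * Q s a + α * (r s a + γ * ∑ s', p s a s' *
    (Finset.univ.sup' Finset.univ_nonempty fun a' => Q s' a'))

/-- The supremum norm `max_{(s,a)} |Q(s,a)|` of a function `Q : S × A → ℝ`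
for nonempty finite `S` and `A`. -/
noncomputable def supNormQ {S A : Type*} [Fintype S] [Fintype A] [Nonempty S] [Nonempty A]
    (Q : S → A → ℝ) : ℝ :=
  Finset.univ.sup' Finset.univ_nonempty fun sa : S × A => |Q sa.1 sa.2|

theorem Finset.abs_sup'_sub_sup'_le {ι : Type*} {t : Finset ι} (ht : t.Nonempty) {f g : ι → ℝ}
    {c : ℝ} (h : ∀ i ∈ t, |f i - g i| ≤ c) : |t.sup' ht f - t.sup' ht g| ≤ c := by
  have sup_le {f g : ι → ℝ} (h : ∀ i ∈ t, |f i - g i| ≤ c) : t.sup' ht f ≤ c + t.sup' ht g :=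
    Finset.sup'_le _ _ fun i hi => by
      linarith [le_abs_self (f i - g i), h i hi, Finset.le_sup' g hi]
  have hgf := sup_le fun i hi => (abs_sub_comm (g i) (f i)).trans_le (h i hi)
  rw [abs_sub_le_iff]
  constructor <;> linarith [sup_le h]

section QLearning

variable {S A : Type*} [Fintype S] [Fintype A] [Nonempty S] [Nonempty A]

theorem abs_le_supNormQ (Q : S → A → ℝ) (s : S) (a : A) : |Q s a| ≤ supNormQ Q :=
  Finset.le_sup' (fun sa : S × A => |Q sa.1 sa.2|) (Finset.mem_univ (s, a))

theorem supNormQ_le {Q : S → A → ℝ} {c : ℝ} (h : ∀ s a, |Q s a| ≤ c) : supNormQ Q ≤ c :=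
  Finset.sup'_le _ _ fun sa _ => h sa.1 sa.2

theorem supNormQ_nonneg (Q : S → A → ℝ) : 0 ≤ supNormQ Q :=
  (abs_nonneg _).trans (abs_le_supNormQ Q (Classical.arbitrary S) (Classical.arbitrary A))

theorem supNormQ_qLearningOp_sub_le (r : S → A → ℝ) {γ α : ℝ} (hγ0 : 0 ≤ γ)
    (hα0 : 0 ≤ α) (hα1 : α ≤ 1) {p : S → A → S → ℝ} (hp0 : ∀ s a s', 0 ≤ p s a s')
    (hp1 : ∀ s a, ∑ s', p s a s' = 1) (Q Q' : S → A → ℝ) :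
    supNormQ (fun s a => qLearningOp r γ α p Q s a - qLearningOp r γ α p Q' s a) ≤
      (1 - α * (1 - γ)) * supNormQ (fun s a => Q s a - Q' s a) := by
  refine supNormQ_le fun s a => ?_
  set c := supNormQ (fun s a => Q s a - Q' s a)
  have hQ (s a) : |Q s a - Q' s a| ≤ c := abs_le_supNormQ (fun s a => Q s a - Q' s a) s a
  set V : (S → A → ℝ) → S → ℝ := fun Q s' =>
    Finset.univ.sup' Finset.univ_nonempty fun a' => Q s' a' with hV
  have hsum : |∑ s', p s a s' * (V Q s' - V Q' s')| ≤ c :=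
    calc
      _ ≤ ∑ s', p s a s' * c := (Finset.abs_sum_le_sum_abs _ _).trans <|
          Finset.sum_le_sum fun s' _ => by
            rw [abs_mul, abs_of_nonneg (hp0 s a s')]
            exact mul_le_mul_of_nonneg_left
              (Finset.abs_sup'_sub_sup'_le _ fun a' _ => hQ s' a') (hp0 s a s')
      _ = c := by rw [← Finset.sum_mul, hp1, one_mul]
  have hdiff : qLearningOp r γ α p Q s a - qLearningOp r γ α p Q' s a =
      (1 - α) * (Q s a - Q' s a) + α * γ * ∑ s', p s a s' * (V Q s' - V Q' s') := by
    simp only [qLearningOp, hV, mul_sub, Finset.sum_sub_distrib]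
    ring
  rw [hdiff]
  calc
    _ ≤ (1 - α) * |Q s a - Q' s a| + α * γ * |∑ s', p s a s' * (V Q s' - V Q' s')| := by
      refine (abs_add_le _ _).trans_eq ?_
      rw [abs_mul, abs_mul (α * γ), abs_of_nonneg (sub_nonneg.2 hα1),
        abs_of_nonneg (mul_nonneg hα0 hγ0)]
    _ ≤ (1 - α) * c + α * γ * c :=
      add_le_add (mul_le_mul_of_nonneg_left (hQ s a) (sub_nonneg.2 hα1))
        (mul_le_mul_of_nonneg_left hsum (mul_nonneg hα0 hγ0))
    _ = (1 - α * (1 - γ)) * c := by ring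

end QLearning

/-- Convergence of Q-learning to the optimal Q-function: the iterates
`Q_{k+1} = L Q_k` satisfy `‖Q_k - Q*‖_∞ ≤ (1 - α(1-γ))^k ‖Q₀ - Q*‖_∞` and hence
converge to `Q*` in the supremum norm. -/
theorem qlearning_converges
    {S A : Type*} [Fintype S] [Fintype A] [Nonempty S] [Nonempty A]
    (r : S → A → ℝ) (γ : ℝ) (hγ0 : 0 ≤ γ) (hγ1 : γ < 1)
    (α : ℝ) (hα0 : 0 < α) (hα1 : α ≤ 1)
    (p : S → A → S → ℝ)
    (hp0 : ∀ s a s', 0 ≤ p s a s') (hp1 : ∀ s a, ∑ s', p s a s' = 1)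
    (Qstar : S → A → ℝ)
    (hQstar : ∀ s a, Qstar s a = r s a + γ * ∑ s', p s a s' *
      (Finset.univ.sup' Finset.univ_nonempty fun a' => Qstar s' a'))
    (Q : ℕ → S → A → ℝ)
    (hQsucc : ∀ k, Q (k + 1) = qLearningOp r γ α p (Q k)) :
    (∀ k, supNormQ (fun s a => Q k s a - Qstar s a) ≤
        (1 - α * (1 - γ)) ^ k * supNormQ (fun s a => Q 0 s a - Qstar s a)) ∧
      Filter.Tendsto (fun k => supNormQ (fun s a => Q k s a - Qstar s a))
        Filter.atTop (nhds 0) := by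
  have hfix : qLearningOp r γ α p Qstar = Qstar := by
    ext s a
    rw [qLearningOp, ← hQstar s a]
    ring
  have hrate0 : 0 ≤ 1 - α * (1 - γ) := by nlinarith
  have hrate1 : 1 - α * (1 - γ) < 1 := by nlinarith
  have hbound : ∀ k, supNormQ (fun s a => Q k s a - Qstar s a) ≤
      (1 - α * (1 - γ)) ^ k * supNormQ (fun s a => Q 0 s a - Qstar s a) := by
    intro k
    induction k with
    | zero => simp
    | succ k ih =>
      have hstep := supNormQ_qLearningOp_sub_le r hγ0 hα0.le hα1 hp0 hp1 (Q k) Qstar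
      rw [hfix, ← hQsucc k] at hstep
      rw [pow_succ', mul_assoc]
      exact hstep.trans (mul_le_mul_of_nonneg_left ih hrate0)
  refine ⟨hbound, squeeze_zero (fun k => supNormQ_nonneg _) hbound ?_⟩
  simpa using (tendsto_pow_atTop_nhds_zero_of_lt_one hrate0 hrate1).mul_const
    (supNormQ (fun s a => Q 0 s a - Qstar s a))
end
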